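/- (Main theorem: last-iterate O(1/√T) rate) Let F be monotone and L-Lipschitz, A maximally monotone, z* a zero of F + A, and let z_{t+1} = J_{α_t A}((1−β_t)z_t + β_t z_0 − α_t F(z_t)) with α_t = 1/(L√(t+γ)), β_t = γ/(t+γ), γ ≥ 2. Then for every T ≥ 1, the tangent residual satisfies inf_{c ∈ A(z_T)} ‖F(z_T) + c‖ ≤ 25γL(√12+1)‖z_0 − z*‖ / √(T−1+γ). -/

import Mathlib

open RealInnerProductSpace

def IsMonotoneOp {d : ℕ}
    (A : EuclideanSpace ℝ (Fin d) → Set (EuclideanSpace ℝ (Fin d))) : Prop :=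
  ∀ x y u v, u ∈ A x → v ∈ A y → (0 : ℝ) ≤ ⟪u - v, x - y⟫

def IsMaximallyMonotone {d : ℕ}
    (A : EuclideanSpace ℝ (Fin d) → Set (EuclideanSpace ℝ (Fin d))) : Prop :=
  IsMonotoneOp A ∧ ∀ B, IsMonotoneOp B → (∀ x, A x ⊆ B x) → B = A


lemma pagd_nonexp {E : Type*} [NormedAddCommGroup E] [InnerProductSpace ℝ E]
    (x c : E) (a : ℝ) (ha : 0 ≤ a) (h : 0 ≤ inner ℝ c x) : ‖x‖ ≤ ‖x + a • c‖ := by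
  have h1 : ‖x + a • c‖ ^ 2 = ‖x‖ ^ 2 + 2 * (a * inner ℝ c x) + ‖a • c‖ ^ 2 := by
    rw [norm_add_sq_real, inner_smul_right, real_inner_comm]
  have h2 : 0 ≤ a * inner ℝ c x := mul_nonneg ha h
  refine le_of_sq_le_sq ?_ (norm_nonneg _)
  nlinarith [sq_nonneg ‖a • c‖]

lemma pagd_mix {E : Type*} [NormedAddCommGroup E] [InnerProductSpace ℝ E]
    (u f : E) (a b L q : ℝ) (ha : 0 ≤ a) (hb : 0 ≤ b) (hL : 0 ≤ L) (hq : 0 ≤ q)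
    (h : 0 ≤ inner ℝ f u) (hf : ‖f‖ ≤ L * ‖u‖) (hqq : a ^ 2 + (b * L) ^ 2 ≤ q ^ 2) :
    ‖a • u - b • f‖ ≤ q * ‖u‖ := by
  have h1 : ‖a • u - b • f‖ ^ 2
      = a ^ 2 * ‖u‖ ^ 2 - 2 * (a * b * inner ℝ f u) + b ^ 2 * ‖f‖ ^ 2 := by
    rw [norm_sub_sq_real, inner_smul_right, inner_smul_left, real_inner_comm, norm_smul,
      norm_smul, mul_pow, mul_pow, Real.norm_eq_abs, Real.norm_eq_abs, sq_abs, sq_abs]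
    simp
    ring
  have h2 : 0 ≤ a * b * inner ℝ f u := mul_nonneg (mul_nonneg ha hb) h
  have h3 : ‖f‖ ^ 2 ≤ (L * ‖u‖) ^ 2 := pow_le_pow_left₀ (norm_nonneg _) hf 2
  refine le_of_sq_le_sq ?_ (by positivity)
  have h4 : b ^ 2 * ‖f‖ ^ 2 ≤ b ^ 2 * (L * ‖u‖) ^ 2 := by gcongr
  have h5 := mul_le_mul_of_nonneg_right hqq (sq_nonneg ‖u‖)
  nlinarith

lemma pagd_aux (x y : ℝ) (hx : 0 ≤ x) (hx5 : x ≤ 1 / 5) (hy : 0 ≤ y) (hyx : y ≤ x / 2) :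
    (1 - y / 2 - x) ^ 2 + y ≤ (1 - 4 / 5 * x) ^ 2 := by
  have h : (x + y / 2) ^ 2 ≤ (5 / 4 * x) ^ 2 :=
    pow_le_pow_left₀ (by linarith) (by linarith) 2
  nlinarith

set_option maxHeartbeats 2000000 in
/-- Main theorem: last-iterate `O(1/√T)` rate for P-AGD. With `F` monotone and
`L`-Lipschitz, `A` maximally monotone with resolvent `J`, `z⋆` a zero of
`F + A`, `α_t = 1/(L√(t+γ))`, `β_t = γ/(t+γ)`, `γ ≥ 2`, and
`z_{t+1} = J_{α_t A}((1−β_t)z_t + β_t z₀ − α_t F z_t)`, for every `T ≥ 1` the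
tangent residual satisfies
`inf_{c ∈ A z_T} ‖F z_T + c‖ ≤ 25γL(√12+1)‖z₀ − z⋆‖/√(T−1+γ)`. -/
theorem pagd_last_iterate_rate {d : ℕ}
    (F : EuclideanSpace ℝ (Fin d) → EuclideanSpace ℝ (Fin d))
    (A : EuclideanSpace ℝ (Fin d) → Set (EuclideanSpace ℝ (Fin d)))
    (L γ : ℝ) (hL : 0 < L) (hγ : 2 ≤ γ)
    (hmono : ∀ z w, (0 : ℝ) ≤ ⟪F z - F w, z - w⟫)
    (hlip : ∀ z w, ‖F z - F w‖ ≤ L * ‖z - w‖)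
    (hA : IsMaximallyMonotone A)
    (J : ℝ → EuclideanSpace ℝ (Fin d) → EuclideanSpace ℝ (Fin d))
    (hJ : ∀ α, 0 < α → ∀ w z, J α w = z ↔ α⁻¹ • (w - z) ∈ A z)
    (α β : ℕ → ℝ)
    (hα : ∀ t : ℕ, α t = 1 / (L * Real.sqrt ((t : ℝ) + γ)))
    (hβ : ∀ t : ℕ, β t = γ / ((t : ℝ) + γ))
    (zs : EuclideanSpace ℝ (Fin d)) (hzs : -F zs ∈ A zs)
    (z : ℕ → EuclideanSpace ℝ (Fin d))
    (hz : ∀ t : ℕ, z (t + 1) =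
      J (α t) ((1 - β t) • z t + β t • z 0 - α t • F (z t))) :
    ∀ T : ℕ, 1 ≤ T →
      sInf {r : ℝ | ∃ c ∈ A (z T), r = ‖F (z T) + c‖} ≤
        25 * γ * L * (Real.sqrt 12 + 1) * ‖z 0 - zs‖ /
          Real.sqrt ((T : ℝ) - 1 + γ) := by
  have hγ0 : 0 < γ := by linarith
  have hspos : ∀ t : ℕ, 0 < (t : ℝ) + γ := fun t => by positivity
  have hαpos : ∀ t, 0 < α t := fun t => by
    rw [hα]; have := Real.sqrt_pos.2 (hspos t); positivity
  have hαL : ∀ t, (α t * L) ^ 2 = 1 / ((t : ℝ) + γ) := fun t => by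
    have h1 := Real.sqrt_pos.2 (hspos t)
    have h2 := Real.sq_sqrt (hspos t).le
    rw [hα, show 1 / (L * √((t : ℝ) + γ)) * L = 1 / √((t : ℝ) + γ) by field_simp, div_pow, h2,
      one_pow]
  -- the dual certificates
  let c : ℕ → EuclideanSpace ℝ (Fin d) := fun t =>
    (α t)⁻¹ • (((1 - β t) • z t + β t • z 0 - α t • F (z t)) - z (t + 1))
  have hc : ∀ t, c t ∈ A (z (t + 1)) := fun t => (hJ (α t) (hαpos t) _ _).1 (hz t).symm
  have hac : ∀ t, α t • c t = ((1 - β t) • z t + β t • z 0 - α t • F (z t)) - z (t + 1) :=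
    fun t => smul_inv_smul₀ (hαpos t).ne' _
  have hβ0 : ∀ t, 0 < β t := fun t => by rw [hβ]; exact div_pos hγ0 (hspos t)
  have hβ1 : ∀ t, β t ≤ 1 := fun t => by
    rw [hβ, div_le_one (hspos t)]; linarith [Nat.cast_nonneg (α := ℝ) t]
  have hβs : ∀ t : ℕ, 1 / ((t : ℝ) + γ) ≤ β t / 2 := fun t => by
    rw [hβ, div_div, div_le_div_iff₀ (hspos t) (by linarith [hspos t])]
    nlinarith [hspos t]
  set D := ‖z 0 - zs‖ with hD
  have hD0 : 0 ≤ D := norm_nonneg _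
  -- boundedness
  have hbd : ∀ t, ‖z t - zs‖ ≤ 100 / 29 * D := by
    intro t
    induction t with
    | zero => linarith
    | succ t ih =>
      have h1 := pagd_nonexp (z (t+1) - zs) (c t - (-F zs)) (α t) (hαpos t).le
        (hA.1 _ _ _ _ (hc t) hzs)
      have h2 : (z (t+1) - zs) + α t • (c t - (-F zs))
          = ((1 - β t) • (z t - zs) - α t • (F (z t) - F zs)) + β t • (z 0 - zs) := by
        rw [smul_sub, hac]; module
      rw [h2] at h1
      have h3 := pagd_mix (z t - zs) (F (z t) - F zs) (1 - β t) (α t) L (1 - 29/100 * β t)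
        (by linarith [hβ1 t]) (hαpos t).le hL.le (by linarith [hβ1 t]) (hmono _ _) (hlip _ _)
        (by rw [hαL]; nlinarith [hβ0 t, hβ1 t, hβs t])
      have h4 := norm_add_le ((1 - β t) • (z t - zs) - α t • (F (z t) - F zs)) (β t • (z 0 - zs))
      rw [norm_smul, Real.norm_of_nonneg (hβ0 t).le, ← hD] at h4
      have h5 : (1 - 29/100 * β t) * ‖z t - zs‖ ≤ (1 - 29/100 * β t) * (100 / 29 * D) :=
        mul_le_mul_of_nonneg_left ih (by linarith [hβ1 t])
      nlinarith
  set R := (√12 + 1) * D with hR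
  have h12 : (100 : ℝ) / 29 ≤ √12 := Real.le_sqrt_of_sq_le (by norm_num)
  have hR0 : 0 ≤ R := by positivity
  have hbR : ∀ t, ‖z t - z 0‖ ≤ R := fun t => by
    have h1 := norm_sub_le_norm_sub_add_norm_sub (z t) zs (z 0)
    rw [norm_sub_rev zs (z 0)] at h1
    have := hbd t
    rw [hR]; nlinarith
  -- increments
  have hinc : ∀ t : ℕ, ‖z (t + 1) - z t‖ ≤ 10 * γ * R / ((t : ℝ) + γ) := by
    intro t
    have triv : ∀ t : ℕ, (t : ℝ) + γ ≤ 5 * γ →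
        ‖z (t + 1) - z t‖ ≤ 10 * γ * R / ((t : ℝ) + γ) := by
      intro t ht
      rw [le_div_iff₀ (hspos t)]
      have h1 := norm_sub_le_norm_sub_add_norm_sub (z (t+1)) (z 0) (z t)
      rw [norm_sub_rev (z 0) (z t)] at h1
      have h2 : ‖z (t + 1) - z t‖ ≤ 2 * R := by linarith [hbR t, hbR (t+1)]
      calc _ ≤ 2 * R * (5 * γ) := mul_le_mul h2 ht (hspos t).le (by positivity)
        _ = _ := by ring
    induction t with
    | zero => exact triv 0 (by push_cast; linarith)
    | succ t ih =>
      by_cases ht : ((t + 1 : ℕ) : ℝ) + γ ≤ 5 * γ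
      · exact triv _ ht
      push Not at ht
      set s : ℝ := ((t + 1 : ℕ) : ℝ) + γ with hs
      have hst : (t : ℝ) + γ = s - 1 := by rw [hs]; push_cast; ring
      rw [hst] at ih
      have hs10 : 10 < s := by linarith
      -- ratio of step sizes
      set r : ℝ := α (t+1) / α t with hr
      have hr0 : 0 < r := div_pos (hαpos _) (hαpos _)
      have hrα : r * α t = α (t+1) := div_mul_cancel₀ _ (hαpos t).ne'
      have hr2 : r ^ 2 * s = s - 1 := by
        have e1 := hαL (t+1)
        have e2 := hαL t
        rw [← hs] at e1
        rw [hst] at e2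
        rw [← hrα, mul_assoc, mul_pow, e2] at e1
        have : s - 1 ≠ 0 := by linarith
        have : s ≠ 0 := by linarith
        field_simp at e1
        linarith
      have hru : r * s ≤ s - 1/2 := by
        refine le_of_sq_le_sq ?_ (by linarith)
        nlinarith
      have hr1 : r ≤ 1 := by nlinarith
      have hβt1 : β (t+1) * s = γ := by
        rw [hβ, ← hs]; field_simp
      have hβt : β t * (s - 1) = γ := by
        rw [hβ, hst]; have : s - 1 ≠ 0 := by linarith
        field_simp
      have hrl : s - 1 ≤ r * s := by nlinarith
      set k : ℝ := r * β t - β (t+1) with hk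
      have hks : k * (s * (s-1)) = γ * (r * s - (s - 1)) := by
        rw [hk]; linear_combination r * s * hβt - (s - 1) * hβt1
      have hss : 0 < s * (s - 1) := by nlinarith
      have hk0 : 0 ≤ k := by
        by_contra hneg
        push Not at hneg
        nlinarith [mul_nonneg hγ0.le (sub_nonneg.2 hrl)]
      have hk1 : k * (s * (s-1)) ≤ γ / 2 := by rw [hks]; nlinarith
      have h1 := pagd_nonexp (z (t+1+1) - z (t+1)) (c (t+1) - c t) (α (t+1)) (hαpos _).le
        (hA.1 _ _ _ _ (hc (t+1)) (hc t))
      have h2 : (z (t+1+1) - z (t+1)) + α (t+1) • (c (t+1) - c t)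
          = ((r - β (t+1)) • (z (t+1) - z t) - α (t+1) • (F (z (t+1)) - F (z t)))
            + k • (z t - z 0) := by
        rw [smul_sub, hac, ← hrα, mul_smul r (α t) (c t), hac, hk]; module
      rw [h2] at h1
      set q : ℝ := 1 - 4/5 * (γ / s) with hq
      have hγs : γ / s ≤ 1/5 := by rw [div_le_iff₀ (by linarith)]; linarith
      have hγs' : β (t+1) = γ / s := by rw [hβ]
      have hs1 : 1 / s ≤ γ / s / 2 := by
        have := hβs (t+1); rwa [← hs, hγs'] at this
      have hγs0 : 0 < γ / s := by rw [← hγs']; exact hβ0 _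
      have hs0 : 0 < 1 / s := by positivity
      have hru' : r ≤ 1 - 1 / s / 2 := by
        have : s ≠ 0 := by linarith
        have e : r = (r * s) / s := by field_simp
        have e' : 1 - 1 / s / 2 = (s - 1/2) / s := by field_simp
        rw [e, e']; gcongr
      have hrl' : 1 - 1 / s ≤ r := by
        have : s ≠ 0 := by linarith
        have e : r = (r * s) / s := by field_simp
        have e' : 1 - 1 / s = (s - 1) / s := by field_simp
        rw [e, e']; gcongr
      have ha0 : 0 ≤ r - β (t+1) := by rw [hγs']; linarith
      have hqq : (r - β (t+1)) ^ 2 + (α (t+1) * L) ^ 2 ≤ q ^ 2 := by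
        rw [hαL, ← hs]
        have e1 : (r - β (t+1)) ^ 2 ≤ (1 - 1 / s / 2 - γ / s) ^ 2 :=
          pow_le_pow_left₀ ha0 (by rw [hγs']; linarith) 2
        rw [hq]
        exact (add_le_add_left e1 _).trans (pagd_aux _ _ hγs0.le hγs hs0.le hs1)
      have h3 := pagd_mix (z (t+1) - z t) (F (z (t+1)) - F (z t)) (r - β (t+1)) (α (t+1)) L q
        ha0 (hαpos _).le hL.le (by rw [hq]; linarith) (hmono _ _) (hlip _ _) hqq
      have h4 := norm_add_le
        ((r - β (t+1)) • (z (t+1) - z t) - α (t+1) • (F (z (t+1)) - F (z t))) (k • (z t - z 0))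
      rw [norm_smul, Real.norm_of_nonneg hk0] at h4
      have h5 : q * ‖z (t+1) - z t‖ ≤ q * (10 * γ * R / (s - 1)) :=
        mul_le_mul_of_nonneg_left ih (by rw [hq]; linarith)
      have h6 : k * ‖z t - z 0‖ ≤ (γ / 2 / (s * (s - 1))) * R := by
        refine mul_le_mul ?_ (hbR t) (norm_nonneg _) (by positivity)
        rw [le_div_iff₀ hss]; exact hk1
      have h7 : q * (10 * γ * R / (s - 1)) + (γ / 2 / (s * (s - 1))) * R ≤ 10 * γ * R / s := by
        have hsn : s ≠ 0 := by linarith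
        have hsn1 : s - 1 ≠ 0 := by linarith
        have e : 10 * γ * R / s - (q * (10 * γ * R / (s - 1)) + (γ / 2 / (s * (s - 1))) * R)
            = γ * R * (8 * γ - 10 - 1/2) / (s * (s - 1)) := by
          rw [hq]; field_simp; ring
        have : 0 ≤ γ * R * (8 * γ - 10 - 1/2) / (s * (s - 1)) :=
          div_nonneg (mul_nonneg (by positivity) (by linarith)) hss.le
        linarith
      linarith
  -- conclusion
  intro T hT
  obtain ⟨t, rfl⟩ : ∃ t, T = t + 1 := ⟨T - 1, by omega⟩
  have hcast : ((t + 1 : ℕ) : ℝ) - 1 + γ = t + γ := by push_cast; ring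
  rw [hcast]
  have hle : sInf {r : ℝ | ∃ c ∈ A (z (t+1)), r = ‖F (z (t+1)) + c‖} ≤ ‖F (z (t+1)) + c t‖ := by
    refine csInf_le ⟨0, ?_⟩ ⟨c t, hc t, rfl⟩
    rintro _ ⟨c, _, rfl⟩
    exact norm_nonneg _
  refine hle.trans ?_
  have hS := hspos t
  set w : ℝ := √((t : ℝ) + γ) with hw
  have hwpos : 0 < w := Real.sqrt_pos.2 hS
  have hww : w ^ 2 = (t : ℝ) + γ := Real.sq_sqrt hS.le
  have hw1 : 1 ≤ w := Real.one_le_sqrt.2 (by linarith [Nat.cast_nonneg (α := ℝ) t])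
  have hαw : (α t)⁻¹ = L * w := by rw [hα, one_div, inv_inv]
  have hdec : F (z (t+1)) + c t
      = (F (z (t+1)) - F (z t)) - (L * w) • (z (t+1) - z t) - (L * w * β t) • (z t - z 0) := by
    have e : c t = (L * w) • (α t • c t) := by
      rw [← hαw, inv_smul_smul₀ (hαpos t).ne']
    have e2 : (L * w) • (α t • F (z t)) = F (z t) := by
      rw [← hαw, inv_smul_smul₀ (hαpos t).ne']
    rw [e, hac, smul_sub, smul_sub, e2]; module
  have hi := hinc t
  rw [← hww] at hi
  have hβw : L * w * β t = L * γ / w := by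
    rw [hβ, ← hww]; field_simp
  have hn : ‖F (z (t+1)) + c t‖
      ≤ L * ‖z (t+1) - z t‖ + L * w * ‖z (t+1) - z t‖ + L * γ / w * R := by
    rw [hdec, hβw]
    refine (norm_sub_le _ _).trans (add_le_add ((norm_sub_le _ _).trans (add_le_add (hlip _ _) ?_)) ?_)
    · rw [norm_smul, Real.norm_of_nonneg (by positivity)]
    · rw [norm_smul, Real.norm_of_nonneg (by positivity)]
      exact mul_le_mul_of_nonneg_left (hbR t) (by positivity)
  refine hn.trans ?_
  have hi2 : L * w * ‖z (t+1) - z t‖ ≤ L * w * (10 * γ * R / w ^ 2) := by gcongr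
  have hi3 : L * ‖z (t+1) - z t‖ ≤ L * w * ‖z (t+1) - z t‖ :=
    mul_le_mul_of_nonneg_right (by nlinarith) (norm_nonneg _)
  have e1 : L * w * (10 * γ * R / w ^ 2) = 10 * (L * γ / w * R) := by field_simp
  have e2 : 25 * γ * L * (√12 + 1) * D / w = 25 * (L * γ / w * R) := by rw [hR]; field_simp
  have e3 : 0 ≤ L * γ / w * R := by positivity
  rw [e2]
  linarith
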